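/- Let H be an induced subgraph of G, let B be a PSD forcing set of G, and let F be a relaxed chronology of PSD forces of B on G with forcing trees T. If B' is the set of initial vertices of the forcing subtrees of T in H (vertices of H that are in B or that are forced in F by a vertex outside their subtree component), then B' is a PSD forcing set of H, the restriction F|_H of F to forces between vertices of H is a relaxed chronology of PSD forces for B' on H, and pt₊(H, F|_H) ≤ pt₊(G, F). -/

import Mathlib

namespace ZF

variable {V : Type*} [Fintype V] [DecidableEq V]

/-- A valid standard zero forcing force within the vertex set `U`, given blue set `B`:
`u` is blue, `v` is its unique white neighbor in `U`. -/
def ZFValid (G : SimpleGraph V) (U B : Set V) (u v : V) : Prop :=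
  u ∈ U ∧ v ∈ U ∧ u ∈ B ∧ v ∉ B ∧ G.Adj u v ∧
    ∀ w ∈ U, G.Adj u w → w ∉ B → w = v

/-- `whiteConn G U B a b` : `a` and `b` are joined by a walk through white
(non-blue) vertices of `U` (possibly trivial). -/
def whiteConn (G : SimpleGraph V) (U B : Set V) : V → V → Prop :=
  Relation.ReflTransGen (fun a b => G.Adj a b ∧ a ∈ U ∧ b ∈ U ∧ a ∉ B ∧ b ∉ B)

/-- A valid PSD force within the vertex set `U`, given blue set `B`:
`u` is blue and `v` is the unique neighbor of `u` in the component of the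
white subgraph containing `v`. -/
def PSDValid (G : SimpleGraph V) (U B : Set V) (u v : V) : Prop :=
  u ∈ U ∧ v ∈ U ∧ u ∈ B ∧ v ∉ B ∧ G.Adj u v ∧
    ∀ w ∈ U, G.Adj u w → w ∉ B → whiteConn G U B v w → w = v

/-- One propagation step for a generic color change rule `valid`. -/
def step (valid : Set V → V → V → Prop) (B : Set V) : Set V :=
  B ∪ {v | ∃ u, valid B u v}

/-- Iterated propagation. -/
def iter (valid : Set V → V → V → Prop) (B : Set V) : ℕ → Set V :=
  fun k => (step valid)^[k] B

/-- `B ⊆ U` is a forcing set of the induced subgraph on `U` for the rule `valid`. -/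
def IsForcingSet (valid : Set V → V → V → Prop) (U B : Set V) : Prop :=
  B ⊆ U ∧ ∃ k, U ⊆ iter valid B k

/-- Propagation time of the set `B` for rule `valid` on the induced subgraph on `U`. -/
noncomputable def propTime (valid : Set V → V → V → Prop) (U B : Set V) : ℕ :=
  sInf {k | U ⊆ iter valid B k}

/-- Vertices blue after `k` time-steps of the family of forces `F`, starting from `B`. -/
def expand (B : Set V) (F : ℕ → Set (V × V)) : ℕ → Set V
  | 0 => B
  | k + 1 => expand B F k ∪ {v | ∃ u, (u, v) ∈ F (k + 1)}

/-- A relaxed chronology of forces (for the rule `valid`) for the forcing set `B`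
on the induced subgraph on `U`, with completion time `K`: at each time-step an
arbitrary subset of the currently valid forces is performed (no vertex being
forced twice in one step), and all of `U` is blue after step `K`. -/
structure RelaxedChron (valid : Set V → V → V → Prop) (U B : Set V)
    (K : ℕ) (F : ℕ → Set (V × V)) : Prop where
  subset : B ⊆ U
  init : F 0 = ∅
  bound : ∀ k, K < k → F k = ∅
  forcesValid : ∀ k < K, ∀ u v, (u, v) ∈ F (k + 1) → valid (expand B F k) u v
  uniqueForcer : ∀ k u₁ u₂ v, (u₁, v) ∈ F k → (u₂, v) ∈ F k → u₁ = u₂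
  complete : U ⊆ expand B F K

/-- The underlying set of forces of a relaxed chronology. -/
def forcesOf (F : ℕ → Set (V × V)) (K : ℕ) : Set (V × V) :=
  {p | ∃ k, 1 ≤ k ∧ k ≤ K ∧ p ∈ F k}

/-- The terminus of a relaxed chronology: the vertices (of `U`) performing no force. -/
def terminus (U : Set V) (F : ℕ → Set (V × V)) (K : ℕ) : Set V :=
  {v ∈ U | ∀ u, (v, u) ∉ forcesOf F K}

/-- The reversal of a relaxed chronology: each force is reversed and
the order of the time-steps is reversed. -/
def revChron (F : ℕ → Set (V × V)) (K : ℕ) : ℕ → Set (V × V) :=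
  fun k => if 1 ≤ k ∧ k ≤ K then {p | (p.2, p.1) ∈ F (K - k + 1)} else ∅

/-- One round of performing all currently valid forces from the set of forces `S`. -/
def forceStep (valid : Set V → V → V → Prop) (S : Set (V × V)) (B : Set V) : Set V :=
  B ∪ {v | ∃ u, (u, v) ∈ S ∧ valid B u v}

def forceIter (valid : Set V → V → V → Prop) (S : Set (V × V)) (B : Set V) : ℕ → Set V :=
  fun t => (forceStep valid S)^[t] B

/-- Propagation time of a set of forces `S` for starting set `B` on `U`. -/
noncomputable def ptForces (valid : Set V → V → V → Prop) (U : Set V)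
    (S : Set (V × V)) (B : Set V) : ℕ :=
  sInf {t | U ⊆ forceIter valid S B t}

/-- `v` is active at time-step `k` of the relaxed chronology `F`:
it is blue after step `k` and has not yet performed a force. -/
def activeAt (B : Set V) (F : ℕ → Set (V × V)) (v : V) (k : ℕ) : Prop :=
  v ∈ expand B F k ∧ ∀ j ≤ k, ∀ u, (v, u) ∉ F j

/-- The zero forcing number. -/
noncomputable def Z (G : SimpleGraph V) : ℕ :=
  sInf {n | ∃ B : Set V, B.ncard = n ∧ IsForcingSet (ZFValid G Set.univ) Set.univ B}

/-- The PSD forcing number. -/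
noncomputable def Zplus (G : SimpleGraph V) : ℕ :=
  sInf {n | ∃ B : Set V, B.ncard = n ∧ IsForcingSet (PSDValid G Set.univ) Set.univ B}

/-- Standard `m`-propagation time `pt(G,m)`. -/
noncomputable def ptm (G : SimpleGraph V) (m : ℕ) : ℕ :=
  sInf {t | ∃ B : Set V, B.ncard = m ∧ IsForcingSet (ZFValid G Set.univ) Set.univ B ∧
    propTime (ZFValid G Set.univ) Set.univ B = t}

/-- PSD `m`-propagation time `pt₊(G,m)`. -/
noncomputable def ptplusm (G : SimpleGraph V) (m : ℕ) : ℕ :=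
  sInf {t | ∃ B : Set V, B.ncard = m ∧ IsForcingSet (PSDValid G Set.univ) Set.univ B ∧
    propTime (PSDValid G Set.univ) Set.univ B = t}

/-- Standard propagation time `pt(G)`. -/
noncomputable def pt (G : SimpleGraph V) : ℕ := ptm G (Z G)

/-- PSD propagation time `pt₊(G)`. -/
noncomputable def ptplus (G : SimpleGraph V) : ℕ := ptplusm G (Zplus G)

/-- PSD throttling number `thr₊(G)`. -/
noncomputable def thrplus (G : SimpleGraph V) : ℕ :=
  sInf {t | ∃ B : Set V, IsForcingSet (PSDValid G Set.univ) Set.univ B ∧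
    t = B.ncard + propTime (PSDValid G Set.univ) Set.univ B}

/-- Closed neighborhood of a set. -/
def closedNbhd (G : SimpleGraph V) (B : Set V) : Set V :=
  B ∪ {v | ∃ u ∈ B, G.Adj u v}

/-- Power domination process: the first step colors the closed neighborhood,
subsequent steps apply the standard zero forcing rule. -/
def pdIter (G : SimpleGraph V) (B : Set V) : ℕ → Set V
  | 0 => B
  | 1 => closedNbhd G B
  | (k + 2) => step (ZFValid G Set.univ) (pdIter G B (k + 1))

/-- `B` is a power dominating set. -/
def IsPDSet (G : SimpleGraph V) (B : Set V) : Prop :=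
  ∃ k, Set.univ ⊆ pdIter G B k

/-- Power propagation time of a set. -/
noncomputable def pdPropTime (G : SimpleGraph V) (B : Set V) : ℕ :=
  sInf {k | Set.univ ⊆ pdIter G B k}

/-- Power `m`-propagation time `ppt(G,m)`. -/
noncomputable def pptm (G : SimpleGraph V) (m : ℕ) : ℕ :=
  sInf {t | ∃ B : Set V, B.ncard = m ∧ IsPDSet G B ∧ pdPropTime G B = t}

/-- Restriction of a family of forces to those with both endpoints in `W`. -/
def restrictF (F : ℕ → Set (V × V)) (W : Set V) : ℕ → Set (V × V) :=
  fun k => {p ∈ F k | p.1 ∈ W ∧ p.2 ∈ W}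

/-- The forcing tree of `b` : all vertices reachable from `b` by a chain of forces in `S`. -/
def treeOf (S : Set (V × V)) (b : V) : Set V :=
  {w | Relation.ReflTransGen (fun a c => (a, c) ∈ S) b w}

open Classical in
/-- The endpoint, after `k` steps, of the path grown from `b ∈ B` in the
path bundle of the relaxed chronology `F` induced by the vertex `x`: the path is
extended by a force from its current endpoint into the component of white
vertices containing `x`, whenever such a force occurs. -/
noncomputable def lastVert (G : SimpleGraph V) (B : Set V) (F : ℕ → Set (V × V))
    (x : V) (b : V) : ℕ → V
  | 0 => b
  | k + 1 =>
    if h : ∃ w, (lastVert G B F x b k, w) ∈ F (k + 1) ∧ x ∉ expand B F k ∧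
        whiteConn G Set.univ (expand B F k) x w
    then h.choose else lastVert G B F x b k

/-- The vertex set of the path bundle of `F` induced by `x`. -/
def bundle (G : SimpleGraph V) (B : Set V) (F : ℕ → Set (V × V)) (x : V) (K : ℕ) : Set V :=
  {v | ∃ b ∈ B, ∃ j ≤ K, lastVert G B F x b j = v}

/-- The path of the bundle grown from `b`, as a list of vertices. -/
noncomputable def bundlePath (G : SimpleGraph V) (B : Set V) (F : ℕ → Set (V × V))
    (x : V) (K : ℕ) (b : V) : List V :=
  ((List.range (K + 1)).map (lastVert G B F x b)).dedup

/-- A nonempty path in `G`, given as a list of distinct consecutively adjacent vertices. -/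
def IsPathList (G : SimpleGraph V) (l : List V) : Prop :=
  l ≠ [] ∧ l.Nodup ∧ l.Chain' G.Adj

/-- `P` is an `(α,β)`-linkage: a collection of pairwise vertex-disjoint paths,
`α` consisting of one endpoint of each path and `β` of the other endpoints. -/
def IsLinkage (G : SimpleGraph V) (α β : Set V) (P : Set (List V)) : Prop :=
  (∀ l ∈ P, IsPathList G l) ∧
  (∀ l ∈ P, ∀ l' ∈ P, l ≠ l' → ∀ v, v ∈ l → v ∉ l') ∧
  (∀ l ∈ P, ∀ l' ∈ P, l.head? = l'.head? → l = l') ∧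
  (∀ l ∈ P, ∀ l' ∈ P, l.getLast? = l'.getLast? → l = l') ∧
  α = {v | ∃ l ∈ P, l.head? = some v} ∧
  β = {v | ∃ l ∈ P, l.getLast? = some v}

/-- `P` is a rigid linkage: for some `α`, `β` it is the unique `(α,β)`-linkage in `G`. -/
def IsRigidLinkage (G : SimpleGraph V) (P : Set (List V)) : Prop :=
  ∃ α β, IsLinkage G α β P ∧ ∀ P', IsLinkage G α β P' → P' = P

/-- A path cover of `G` : `m` vertex-disjoint induced paths covering all vertices,
the `i`-th path having vertices `vtx i 0, …, vtx i (n i − 1)` in path order. -/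
structure IsPathCover (G : SimpleGraph V) (m : ℕ) (n : Fin m → ℕ)
    (vtx : (i : Fin m) → Fin (n i) → V) : Prop where
  pos : ∀ i, 0 < n i
  inj : Function.Injective (fun p : (i : Fin m) × Fin (n i) => vtx p.1 p.2)
  cover : ∀ v : V, ∃ i j, vtx i j = v
  induced : ∀ i (j j' : Fin (n i)),
    G.Adj (vtx i j) (vtx i j') ↔ ((j : ℕ) + 1 = (j' : ℕ) ∨ (j' : ℕ) + 1 = (j : ℕ))

/-- A witness that a path cover is a parallel increasing path cover: a collection of
block partitions of `{0,…,K}`, one per path, compatible with the edges of `G`. -/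
structure IsPIPWitness (G : SimpleGraph V) (m : ℕ) (n : Fin m → ℕ)
    (vtx : (i : Fin m) → Fin (n i) → V) (K : ℕ)
    (A : (i : Fin m) → Fin (n i) → Finset ℕ) : Prop where
  mem : ∀ i j, A i j ⊆ Finset.range (K + 1)
  nonempty : ∀ i j, (A i j).Nonempty
  partition : ∀ i, ∀ x ∈ Finset.range (K + 1), ∃! j, x ∈ A i j
  mono : ∀ i (j j' : Fin (n i)), (j : ℕ) < (j' : ℕ) → ∀ x ∈ A i j, ∀ y ∈ A i j', x < y
  edge : ∀ (i i' : Fin m) j j', i ≠ i' →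
    G.Adj (vtx i j) (vtx i' j') → ((A i j) ∩ (A i' j')).Nonempty

/-- A parallel increasing path cover of `G`. -/
def IsPIP (G : SimpleGraph V) (m : ℕ) (n : Fin m → ℕ)
    (vtx : (i : Fin m) → Fin (n i) → V) : Prop :=
  IsPathCover G m n vtx ∧ ∃ K A, IsPIPWitness G m n vtx K A

/-- The path cover given by `vtx` is the chain set of the family of forces `F` :
the underlying forces are exactly the consecutive pairs along the paths. -/
def IsChainSetOf (m : ℕ) (n : Fin m → ℕ) (vtx : (i : Fin m) → Fin (n i) → V)
    (F : ℕ → Set (V × V)) (K : ℕ) : Prop :=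
  ∀ u w, (u, w) ∈ forcesOf F K ↔
    ∃ (i : Fin m) (j : Fin (n i)) (j' : Fin (n i)),
      u = vtx i j ∧ w = vtx i j' ∧ (j : ℕ) + 1 = (j' : ℕ)

end ZF
namespace ZF

theorem psdValid_mono {V : Type*} (G : SimpleGraph V) {U W A A' : Set V} {u v : V}
    (hWU : W ⊆ U) (hA : A ∩ W ⊆ A') (h : PSDValid G U A u v) (hu : u ∈ W) (hv : v ∈ W)
    (hvA : v ∉ A') : PSDValid G W A' u v := by
  obtain ⟨_, _, huA, _, hadj, huniq⟩ := h
  refine ⟨hu, hv, hA ⟨huA, hu⟩, hvA, hadj, ?_⟩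
  intro w hw hadj' hwA hconn
  refine huniq w (hWU hw) hadj' (fun h => hwA (hA ⟨h, hw⟩)) ?_
  refine Relation.ReflTransGen.mono (r := fun a b => G.Adj a b ∧ a ∈ W ∧ b ∈ W ∧ a ∉ A' ∧ b ∉ A') ?_ v w hconn
  rintro a b ⟨h1, h2, h3, h4, h5⟩
  exact ⟨h1, hWU h2, hWU h3, fun h => h4 (hA ⟨h, h2⟩), fun h => h5 (hA ⟨h, h3⟩)⟩

theorem expand_mono {V : Type*} (B : Set V) (F : ℕ → Set (V × V)) : Monotone (expand B F) :=
  monotone_nat_of_le_succ fun _ => Set.subset_union_left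

theorem forceIter_succ {V : Type*} (val : Set V → V → V → Prop) (S : Set (V × V)) (B : Set V)
    (t : ℕ) : forceIter val S B (t + 1) = forceStep val S (forceIter val S B t) := by
  simp only [forceIter, Function.iterate_succ_apply']

theorem iter_succ {V : Type*} (val : Set V → V → V → Prop) (B : Set V)
    (t : ℕ) : iter val B (t + 1) = step val (iter val B t) := by
  simp only [iter, Function.iterate_succ_apply']

theorem forceIter_subset_iter {V : Type*} (G : SimpleGraph V) (U : Set V) (S : Set (V × V))
    (B : Set V) (t : ℕ) : forceIter (PSDValid G U) S B t ⊆ iter (PSDValid G U) B t := by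
  induction t with
  | zero => exact subset_rfl
  | succ t ih =>
    rw [forceIter_succ, iter_succ]
    rintro v (hv | ⟨u, _, hval⟩)
    · exact Or.inl (ih hv)
    · by_cases hv : v ∈ iter (PSDValid G U) B t
      · exact Or.inl hv
      · exact Or.inr ⟨u, psdValid_mono G subset_rfl (fun x hx => ih hx.1) hval hval.1 hval.2.1 hv⟩

theorem expand_subset_forceIter {V : Type*} (G : SimpleGraph V) (U B : Set V) (K : ℕ)
    (F : ℕ → Set (V × V)) (hF : RelaxedChron (PSDValid G U) U B K F) (t : ℕ) :
    expand B F t ⊆ forceIter (PSDValid G U) (forcesOf F K) B t := by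
  induction t with
  | zero => exact subset_rfl
  | succ t ih =>
    rw [forceIter_succ]
    rintro v (hv | ⟨u, hu⟩)
    · exact Or.inl (ih hv)
    · have ht : t < K := by
        by_contra h
        rw [hF.bound (t + 1) (by omega)] at hu
        exact hu
      have hval := hF.forcesValid t ht u v hu
      by_cases hv : v ∈ forceIter (PSDValid G U) (forcesOf F K) B t
      · exact Or.inl hv
      · exact Or.inr ⟨u, ⟨t + 1, by omega, by omega, hu⟩,
          psdValid_mono G subset_rfl (fun x hx => ih hx.1) hval hval.1 hval.2.1 hv⟩

theorem forcer_unique {V : Type*} (G : SimpleGraph V) (U B : Set V) (K : ℕ)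
    (F : ℕ → Set (V × V)) (hF : RelaxedChron (PSDValid G U) U B K F) {i j : ℕ} {u u' v : V}
    (hi : (u, v) ∈ F i) (hj : (u', v) ∈ F j) : i = j := by
  have key : ∀ {i j : ℕ} {u u' : V}, (u, v) ∈ F i → (u', v) ∈ F j → i < j → False := by
    intro i j u u' hi hj hij
    have hjK : j ≤ K := by
      by_contra h
      rw [hF.bound j (by omega)] at hj
      exact hj
    obtain ⟨i, rfl⟩ : ∃ i', i = i' + 1 := by
      cases i with
      | zero => rw [hF.2] at hi; exact hi.elim
      | succ n => exact ⟨n, rfl⟩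
    obtain ⟨j, rfl⟩ : ∃ j', j = j' + 1 := ⟨j - 1, by omega⟩
    refine (hF.forcesValid j (by omega) u' v hj).2.2.2.1 ?_
    exact expand_mono B F (show i + 1 ≤ j by omega) (Or.inr ⟨u, hi⟩)
  rcases lt_trichotomy i j with h | h | h
  · exact (key hi hj h).elim
  · exact h
  · exact (key hj hi h).elim

theorem restrict_chron {V : Type*} (G : SimpleGraph V) (W B : Set V) (K : ℕ)
    (F : ℕ → Set (V × V)) (hF : RelaxedChron (PSDValid G Set.univ) Set.univ B K F) :
    RelaxedChron (PSDValid G W) W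
      {v ∈ W | v ∈ B ∨ ∃ u, (u, v) ∈ forcesOf F K ∧ u ∉ W} K (restrictF F W) := by
  set B' : Set V := {v ∈ W | v ∈ B ∨ ∃ u, (u, v) ∈ forcesOf F K ∧ u ∉ W} with hB'
  have lower : ∀ k, expand B F k ∩ W ⊆ expand B' (restrictF F W) k := by
    intro k
    induction k with
    | zero => rintro v ⟨hv, hw⟩; exact ⟨hw, Or.inl hv⟩
    | succ k ih =>
      rintro v ⟨hv | ⟨u, hu⟩, hw⟩
      · exact Or.inl (ih ⟨hv, hw⟩)
      · by_cases huW : u ∈ W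
        · exact Or.inr ⟨u, hu, huW, hw⟩
        · have hk : k + 1 ≤ K := by
            by_contra h
            rw [hF.bound (k + 1) (by omega)] at hu
            exact hu
          exact expand_mono B' _ (Nat.zero_le (k + 1))
            (show v ∈ B' from ⟨hw, Or.inr ⟨u, ⟨k + 1, by omega, hk, hu⟩, huW⟩⟩)
  have upper : ∀ k, expand B' (restrictF F W) k ⊆ B' ∪ expand B F k := by
    intro k
    induction k with
    | zero => exact fun v hv => Or.inl hv
    | succ k ih =>
      rintro v (hv | ⟨u, hu⟩)
      · exact (ih hv).imp id Or.inl
      · exact Or.inr (Or.inr ⟨u, hu.1⟩)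
  refine ⟨fun v hv => hv.1, ?_, ?_, ?_, ?_, fun v hv => lower K ⟨hF.complete trivial, hv⟩⟩
  · ext p; simp [restrictF, hF.2]
  · intro k hk; ext p; simp [restrictF, hF.bound k hk]
  · rintro k hk u v ⟨huv, huW, hvW⟩
    have hval := hF.forcesValid k hk u v huv
    refine psdValid_mono G (Set.subset_univ _) (lower k) hval huW hvW fun hv => ?_
    rcases upper k hv with ⟨_, hv | ⟨u', ⟨j, _, _, hj⟩, hu'⟩⟩ | hv
    · exact hval.2.2.2.1 (expand_mono B F (Nat.zero_le k) hv)
    · have := forcer_unique G _ B K F hF huv hj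
      subst this
      exact hu' (hF.uniqueForcer _ _ _ _ hj huv ▸ huW)
    · exact hval.2.2.2.1 hv
  · rintro k u₁ u₂ v h₁ h₂
    exact hF.uniqueForcer k u₁ u₂ v h₁.1 h₂.1

end ZF

/-- Restriction of a relaxed chronology of PSD forces to an induced subgraph on `W`:
the set `B'` of initial vertices of the forcing subtrees in `W` is a PSD forcing set of
`G[W]`, the restriction of `F` is a relaxed chronology of PSD forces for `B'` on `G[W]`,
and its PSD propagation time is at most that of `F` on `G`. -/
theorem psd_restrict {V : Type*} [Fintype V] [DecidableEq V]
    (G : SimpleGraph V) (W B : Set V) (K : ℕ) (F : ℕ → Set (V × V))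
    (hB : ZF.IsForcingSet (ZF.PSDValid G Set.univ) Set.univ B)
    (hF : ZF.RelaxedChron (ZF.PSDValid G Set.univ) Set.univ B K F) :
    ZF.IsForcingSet (ZF.PSDValid G W) W
        {v ∈ W | v ∈ B ∨ ∃ u, (u, v) ∈ ZF.forcesOf F K ∧ u ∉ W} ∧
    ZF.RelaxedChron (ZF.PSDValid G W) W
        {v ∈ W | v ∈ B ∨ ∃ u, (u, v) ∈ ZF.forcesOf F K ∧ u ∉ W} K (ZF.restrictF F W) ∧
    ZF.ptForces (ZF.PSDValid G W) W (ZF.forcesOf (ZF.restrictF F W) K)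
        {v ∈ W | v ∈ B ∨ ∃ u, (u, v) ∈ ZF.forcesOf F K ∧ u ∉ W}
      ≤ ZF.ptForces (ZF.PSDValid G Set.univ) Set.univ (ZF.forcesOf F K) B := by
  have hR := ZF.restrict_chron G W B K F hF
  refine ⟨⟨hR.subset, K, ?_⟩, hR, ?_⟩
  · exact (hR.complete.trans (ZF.expand_subset_forceIter G _ _ K _ hR K)).trans
      (ZF.forceIter_subset_iter _ _ _ _ _)
  · have hmem : ZF.ptForces (ZF.PSDValid G Set.univ) Set.univ (ZF.forcesOf F K) B ∈
        {t | Set.univ ⊆ ZF.forceIter (ZF.PSDValid G Set.univ) (ZF.forcesOf F K) B t} :=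
      Nat.sInf_mem ⟨K, hF.complete.trans (ZF.expand_subset_forceIter G _ _ K _ hF K)⟩
    refine Nat.sInf_le ?_
    set B' : Set V := {v ∈ W | v ∈ B ∨ ∃ u, (u, v) ∈ ZF.forcesOf F K ∧ u ∉ W}
    have hstart : ∀ t, B' ⊆ ZF.forceIter (ZF.PSDValid G W)
        (ZF.forcesOf (ZF.restrictF F W) K) B' t := by
      intro t
      induction t with
      | zero => exact subset_rfl
      | succ t ih => rw [ZF.forceIter_succ]; exact ih.trans Set.subset_union_left
    have key : ∀ t, ZF.forceIter (ZF.PSDValid G Set.univ) (ZF.forcesOf F K) B t ∩ W ⊆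
        ZF.forceIter (ZF.PSDValid G W) (ZF.forcesOf (ZF.restrictF F W) K) B' t := by
      intro t
      induction t with
      | zero => rintro v ⟨hv, hw⟩; exact ⟨hw, Or.inl hv⟩
      | succ t ih =>
        rintro v ⟨hv, hw⟩
        rw [ZF.forceIter_succ] at hv
        rcases hv with hv | ⟨u, huS, hval⟩
        · rw [ZF.forceIter_succ]; exact Or.inl (ih ⟨hv, hw⟩)
        · by_cases huW : u ∈ W
          · rw [ZF.forceIter_succ]
            by_cases hv : v ∈ ZF.forceIter (ZF.PSDValid G W)
                (ZF.forcesOf (ZF.restrictF F W) K) B' t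
            · exact Or.inl hv
            · obtain ⟨k, h1, h2, h3⟩ := huS
              exact Or.inr ⟨u, ⟨k, h1, h2, h3, huW, hw⟩,
                ZF.psdValid_mono G (Set.subset_univ _) ih hval huW hw hv⟩
          · exact hstart (t + 1) ⟨hw, Or.inr ⟨u, huS, huW⟩⟩
    exact fun v hv => key _ ⟨hmem trivial, hv⟩
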